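/- For each n, let 𝒜^{(0)} be the family of associative trees on n variables of size at least 3 (so that the root is an internal node) none of whose root's children is a leaf. Then the limiting ratio μ_n(𝒜^{(0)}) exists for every n and satisfies μ_n(𝒜^{(0)}) = 1/(n√(2n)) + O(1/n²) as n → ∞. -/

import Mathlib

/-- An and/or tree skeleton: leaves carry a variable index and a polarity
(`true` = positive literal, `false` = negated literal); internal nodes carry
a connective (`true` = AND, `false` = OR) and a list of children. -/
inductive AT (n : ℕ) : Type
  | leaf : Fin n → Bool → AT n
  | node : Bool → List (AT n) → AT n

namespace AT

/-- The connective at the root, if the root is an internal node. -/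
def rootConn {n : ℕ} : AT n → Option Bool
  | .leaf _ _ => none
  | .node c _ => some c

/-- Whether a tree is a single leaf. -/
def isLeafB {n : ℕ} : AT n → Bool
  | .leaf _ _ => true
  | .node _ _ => false

/-- The children of the root. -/
def rootChildren {n : ℕ} : AT n → List (AT n)
  | .leaf _ _ => []
  | .node _ ts => ts

/-- Well-formedness: an associative tree is a plane tree in which each internal
node has at least two children, no internal node has the same connective as its
parent (stratification), and leaves carry literals. -/
inductive WF {n : ℕ} : AT n → Prop
  | leaf (i : Fin n) (b : Bool) : WF (.leaf i b)
  | node (c : Bool) (ts : List (AT n)) :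
      2 ≤ ts.length → (∀ t ∈ ts, WF t) → (∀ t ∈ ts, rootConn t ≠ some c) →
      WF (.node c ts)

mutual
/-- The size of a tree: its total number of nodes. -/
def size {n : ℕ} : AT n → ℕ
  | .leaf _ _ => 1
  | .node _ ts => 1 + sizeList ts
def sizeList {n : ℕ} : List (AT n) → ℕ
  | [] => 0
  | t :: ts => size t + sizeList ts
end

mutual
/-- The Boolean function computed by a tree. -/
def eval {n : ℕ} : AT n → (Fin n → Bool) → Bool
  | .leaf i b, x => if b then x i else ! x i
  | .node c ts, x => evalList c ts x
def evalList {n : ℕ} : Bool → List (AT n) → (Fin n → Bool) → Bool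
  | c, [], _ => c
  | c, t :: ts, x => if c then eval t x && evalList c ts x
                     else eval t x || evalList c ts x
end

end AT

open AT

/-- Number of associative trees of size `m` in a family `𝒯`. -/
noncomputable def countIn (n : ℕ) (𝒯 : Set (AT n)) (m : ℕ) : ℕ :=
  Nat.card {t : AT n // t ∈ 𝒯 ∧ WF t ∧ size t = m}

/-- `A n m` is the number of associative trees of size `m` on `n` variables. -/
noncomputable def A (n m : ℕ) : ℕ := countIn n Set.univ m

/-- `Pmn n m f` is the proportion, among associative trees of size `m` on `n`
variables, of those computing the Boolean function `f`. -/
noncomputable def Pmn (n m : ℕ) (f : (Fin n → Bool) → Bool) : ℝ :=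
  (countIn n {t | eval t = f} m : ℝ) / (A n m : ℝ)

/-- Ratio of trees of size `m` in the family `𝒯` among all trees of size `m`. -/
noncomputable def ratio (n : ℕ) (𝒯 : Set (AT n)) (m : ℕ) : ℝ :=
  (countIn n 𝒯 m : ℝ) / (A n m : ℝ)

/-- `HasLimRatio n 𝒯 μ` : the limiting ratio of the family `𝒯` exists and is `μ`. -/
def HasLimRatio (n : ℕ) (𝒯 : Set (AT n)) (μ : ℝ) : Prop :=
  Filter.Tendsto (ratio n 𝒯) Filter.atTop (nhds μ)

/-- Extension of a Boolean function of `n₀` variables to `n ≥ n₀` variables. -/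
def extend {n₀ n : ℕ} (h : n₀ ≤ n) (f : (Fin n₀ → Bool) → Bool) :
    (Fin n → Bool) → Bool :=
  fun x => f (fun j => x (Fin.castLE h j))

open Classical in
/-- The tree size complexity of a Boolean function. -/
noncomputable def Lcomp (n : ℕ) (f : (Fin n → Bool) → Bool) : ℕ :=
  if f = (fun _ => true) ∨ f = (fun _ => false) then 0
  else if ∃ i : Fin n, f = (fun x => x i) ∨ f = (fun x => ! x i) then 2
  else sInf {m | ∃ t : AT n, WF t ∧ size t = m ∧ eval t = f}

/-- The family `𝒜⁽⁰⁾` of associative trees of size at least 3 none of whose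
root's children is a leaf. -/
def A0fam (n : ℕ) : Set (AT n) :=
  {t | 3 ≤ size t ∧ ∀ s ∈ rootChildren t, isLeafB s = false}


section Comb
open PowerSeries

/-- Generating function of a predicate `P` counted by the weight `w`. -/
noncomputable def GF {α : Type} (w : α → ℕ) (P : α → Prop) : PowerSeries ℝ :=
  PowerSeries.mk fun m => (({a | P a ∧ w a = m}.ncard : ℕ) : ℝ)

theorem GF_congr {α : Type} (w : α → ℕ) {P Q : α → Prop} (h : ∀ a, P a ↔ Q a) :
    GF w P = GF w Q := by
  have : P = Q := funext fun a => propext (h a)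
  rw [this]

theorem GF_or {α : Type} (w : α → ℕ) (hw : ∀ m, {a | w a = m}.Finite) {P Q : α → Prop}
    (h : ∀ a, P a → Q a → False) :
    GF w (fun a => P a ∨ Q a) = GF w P + GF w Q := by
  ext m
  simp only [GF, coeff_mk, map_add]
  have e : {a | (P a ∨ Q a) ∧ w a = m} = {a | P a ∧ w a = m} ∪ {a | Q a ∧ w a = m} := by
    ext a; simp only [Set.mem_ofPred_eq, Set.mem_union]; tauto
  rw [e, Set.ncard_union_eq _ ((hw m).subset fun a ha => ha.2) ((hw m).subset fun a ha => ha.2)]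
  · push_cast; rfl
  · rw [Set.disjoint_left]; rintro a ⟨h1, _⟩ ⟨h2, _⟩; exact h a h1 h2

theorem GF_inj {α β : Type} (w : α → ℕ) (w' : β → ℕ) (f : α → β) (hf : Function.Injective f)
    (hww : ∀ a, w' (f a) = w a) (P : α → Prop) :
    GF w' (fun b => ∃ a, P a ∧ f a = b) = GF w P := by
  ext m
  simp only [GF, coeff_mk]
  have e : {b | (∃ a, P a ∧ f a = b) ∧ w' b = m} = f '' {a | P a ∧ w a = m} := by
    ext b
    simp only [Set.mem_ofPred_eq, Set.mem_image]
    constructor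
    · rintro ⟨⟨a, ha, rfl⟩, hb⟩; exact ⟨a, ⟨ha, by rw [← hww, hb]⟩, rfl⟩
    · rintro ⟨a, ⟨ha, hb⟩, rfl⟩; exact ⟨⟨a, ha, rfl⟩, by rw [hww, hb]⟩
  rw [e, Set.ncard_image_of_injective _ hf]

theorem GF_inj_succ {α β : Type} (w : α → ℕ) (w' : β → ℕ) (f : α → β)
    (hf : Function.Injective f)
    (hww : ∀ a, w' (f a) = 1 + w a) (P : α → Prop) :
    GF w' (fun b => ∃ a, P a ∧ f a = b) = X * GF w P := by
  rw [GF_inj (fun a => 1 + w a) w' f hf hww P]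
  ext m
  cases m with
  | zero => simp [GF]
  | succ m =>
    rw [coeff_succ_X_mul]
    simp only [GF, coeff_mk]
    have : {a | P a ∧ 1 + w a = m + 1} = {a | P a ∧ w a = m} := by
      ext a
      simp only [Set.mem_ofPred_eq]
      constructor <;> rintro ⟨h1, h2⟩ <;> exact ⟨h1, by omega⟩
    rw [this]

theorem GF_prod {α β : Type} (w : α → ℕ) (w' : β → ℕ) (hw : ∀ m, {a | w a = m}.Finite)
    (hw' : ∀ m, {a | w' a = m}.Finite) (P : α → Prop) (Q : β → Prop) :
    GF (fun p : α × β => w p.1 + w' p.2) (fun p => P p.1 ∧ Q p.2) = GF w P * GF w' Q := by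
  classical
  ext m
  rw [coeff_mul]
  simp only [GF, coeff_mk]
  have f1 : ∀ i, {a | P a ∧ w a = i}.Finite := fun i => (hw i).subset fun a ha => ha.2
  have f2 : ∀ i, {a | Q a ∧ w' a = i}.Finite := fun i => (hw' i).subset fun a ha => ha.2
  have e : {p : α × β | (P p.1 ∧ Q p.2) ∧ w p.1 + w' p.2 = m} =
      (((Finset.HasAntidiagonal.antidiagonal m).biUnion fun ij =>
        (f1 ij.1).toFinset ×ˢ (f2 ij.2).toFinset : Finset (α × β)) : Set (α × β)) := by
    ext p
    simp only [Set.mem_ofPred_eq, Finset.coe_biUnion, Finset.mem_coe, Finset.HasAntidiagonal.mem_antidiagonal,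
      Set.mem_iUnion, Finset.mem_product, Set.Finite.mem_toFinset, exists_prop, Prod.exists]
    constructor
    · rintro ⟨⟨h1, h2⟩, h3⟩; exact ⟨_, _, h3, ⟨h1, rfl⟩, h2, rfl⟩
    · rintro ⟨i, j, h, ⟨h1, rfl⟩, h2, rfl⟩; exact ⟨⟨h1, h2⟩, h⟩
  rw [e, Set.ncard_coe_finset, Finset.card_biUnion]
  · push_cast
    refine Finset.sum_congr rfl fun ij _ => ?_
    rw [Finset.card_product, Set.ncard_eq_toFinset_card _ (f1 _),
      Set.ncard_eq_toFinset_card _ (f2 _)]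
    push_cast; rfl
  · intro x _ y _ hxy
    rw [Function.onFun, Finset.disjoint_left]
    intro p hp hq
    simp only [Finset.mem_product, Set.Finite.mem_toFinset, Set.mem_ofPred_eq] at hp hq
    apply hxy
    ext
    · rw [← hp.1.2, hq.1.2]
    · rw [← hp.2.2, hq.2.2]

theorem size_pos' {n : ℕ} (t : AT n) : 1 ≤ size t := by
  cases t <;> simp [size]

theorem fin_aux (n m : ℕ) : {t : AT n | size t ≤ m}.Finite ∧ {t : List (AT n) | sizeList t ≤ m}.Finite := by
  induction m with
  | zero =>
    constructor
    · convert Set.finite_empty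
      ext t; have := size_pos' t; simp; omega
    · refine (Set.finite_singleton []).subset ?_
      intro l hl
      cases l with
      | nil => simp
      | cons t l => have := size_pos' t; simp [sizeList] at hl; omega
  | succ m ih =>
    have h1 : {t : AT n | size t ≤ m + 1}.Finite := by
      refine ((Set.finite_range fun p : Fin n × Bool => AT.leaf p.1 p.2).union
        (((Set.finite_univ (α := Bool)).prod ih.2).image fun p => AT.node p.1 p.2)).subset ?_
      intro t ht
      cases t with
      | leaf i b => left; exact ⟨(i, b), rfl⟩
      | node c ts =>
        right
        simp only [Set.mem_ofPred_eq, size] at ht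
        exact ⟨(c, ts), ⟨trivial, by simp; omega⟩, rfl⟩
    refine ⟨h1, ?_⟩
    refine ((Set.finite_singleton []).union ((h1.prod ih.2).image fun p => p.1 :: p.2)).subset ?_
    intro l hl
    cases l with
    | nil => left; rfl
    | cons t l =>
      right
      have := size_pos' t
      simp only [Set.mem_ofPred_eq, sizeList] at hl
      exact ⟨(t, l), ⟨by simp; omega, by simp; omega⟩, rfl⟩

theorem fin_tree (n m : ℕ) : {t : AT n | size t = m}.Finite :=
  (fin_aux n m).1.subset fun _ h => le_of_eq h

theorem fin_list (n m : ℕ) : {t : List (AT n) | sizeList t = m}.Finite :=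
  (fin_aux n m).2.subset fun _ h => le_of_eq h

theorem GF_list {n : ℕ} (P : AT n → Prop) :
    GF (α := List (AT n)) sizeList (fun l => ∀ t ∈ l, P t) * (1 - GF size P) = 1 := by
  have e := GF_congr (α := List (AT n)) sizeList (P := fun l => ∀ t ∈ l, P t)
    (Q := fun l => l = [] ∨ ∃ p : AT n × List (AT n), (P p.1 ∧ ∀ t ∈ p.2, P t) ∧ p.1 :: p.2 = l)
    (by
      intro l
      cases l <;> simp)
  rw [GF_or _ (fin_list n) (by rintro l rfl ⟨p, _, h⟩; simp at h),
    GF_inj (fun p : AT n × List (AT n) => size p.1 + sizeList p.2) sizeList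
      (fun p : AT n × List (AT n) => p.1 :: p.2) (by rintro ⟨a, b⟩ ⟨c, d⟩ h; simpa using h)
      (by intro a; simp [sizeList]) (fun p => P p.1 ∧ ∀ t ∈ p.2, P t),
    GF_prod (w := size) (w' := sizeList) (fin_tree n) (fin_list n) P (fun l => ∀ t ∈ l, P t)] at e
  have e1 : GF (α := List (AT n)) sizeList (fun l => l = []) = 1 := by
    ext m
    simp only [GF, coeff_mk, coeff_one]
    split_ifs with h
    · subst h
      have : {l : List (AT n) | l = [] ∧ sizeList l = 0} = {[]} := by
        ext l; simp only [Set.mem_ofPred_eq, Set.mem_singleton_iff]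
        constructor
        · exact fun h => h.1
        · rintro rfl; simp [sizeList]
      rw [this]; simp
    · have : {l : List (AT n) | l = [] ∧ sizeList l = m} = ∅ := by
        ext l; simp only [Set.mem_ofPred_eq, Set.mem_empty_iff_false, iff_false]
        rintro ⟨rfl, h2⟩; simp [sizeList] at h2; omega
      rw [this]; simp
  rw [e1] at e
  linear_combination e

/-- Nodes with connective `c` and at least two children all satisfying `P`. -/
def NodeOf {n : ℕ} (c : Bool) (P : AT n → Prop) (t : AT n) : Prop :=
  ∃ ts, (2 ≤ ts.length ∧ ∀ s ∈ ts, P s) ∧ AT.node c ts = t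

theorem GF_node {n : ℕ} (c : Bool) (P : AT n → Prop) :
    GF size (NodeOf c P) = X * ((GF size P) ^ 2 *
      GF (α := List (AT n)) sizeList (fun l => ∀ t ∈ l, P t)) := by
  unfold NodeOf
  rw [GF_inj_succ (α := List (AT n)) sizeList size (fun ts => AT.node c ts)
    (by intro a b h; simpa using h) (by intro a; simp [size])
    (fun ts => 2 ≤ ts.length ∧ ∀ s ∈ ts, P s)]
  congr 1
  have e := GF_congr (α := List (AT n)) sizeList (P := fun l => 2 ≤ l.length ∧ ∀ t ∈ l, P t)
    (Q := fun l => ∃ p : AT n × (AT n × List (AT n)),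
      (P p.1 ∧ (P p.2.1 ∧ ∀ t ∈ p.2.2, P t)) ∧ p.1 :: p.2.1 :: p.2.2 = l)
    (by
      intro l
      rcases l with _ | ⟨a, _ | ⟨b, l⟩⟩ <;> simp)
  have fp : ∀ m, {p : AT n × List (AT n) | size p.1 + sizeList p.2 = m}.Finite := by
    intro m
    refine ((fin_aux n m).1.prod (fin_aux n m).2).subset ?_
    rintro ⟨a, b⟩ h
    simp only [Set.mem_ofPred_eq] at h
    exact ⟨by simp; omega, by simp; omega⟩
  rw [e, GF_inj (fun p : AT n × (AT n × List (AT n)) => size p.1 + (size p.2.1 + sizeList p.2.2))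
      sizeList (fun p : AT n × (AT n × List (AT n)) => p.1 :: p.2.1 :: p.2.2)
      (by rintro ⟨a, b, c⟩ ⟨d, e, f⟩ h; simpa using h)
      (by intro a; simp [sizeList]) (fun p => P p.1 ∧ (P p.2.1 ∧ ∀ t ∈ p.2.2, P t)),
    GF_prod (w := size) (w' := fun p : AT n × List (AT n) => size p.1 + sizeList p.2)
      (fin_tree n) fp P (fun p => P p.1 ∧ ∀ t ∈ p.2, P t),
    GF_prod (w := size) (w' := sizeList) (fin_tree n) (fin_list n) P (fun l => ∀ t ∈ l, P t)]
  ring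

theorem GF_leaf {n : ℕ} :
    GF size (fun t : AT n => isLeafB t = true) = C (2 * n : ℝ) * X := by
  ext m
  simp only [GF, coeff_mk, coeff_C_mul, coeff_X]
  split_ifs with h
  · subst h
    have : {t : AT n | isLeafB t = true ∧ size t = 1} =
        (fun p : Fin n × Bool => AT.leaf p.1 p.2) '' Set.univ := by
      ext t
      cases t <;> simp [isLeafB, size]
    rw [this, Set.ncard_image_of_injective, Set.ncard_univ]
    · simp [mul_comm]
    · rintro ⟨a, b⟩ ⟨c, d⟩ h; simpa using h
  · have : {t : AT n | isLeafB t = true ∧ size t = m} = ∅ := by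
      ext t
      cases t with
      | leaf i b => simp [isLeafB, size]; omega
      | node c ts => simp [isLeafB]
    rw [this]; simp

/-- Well-formed trees that may be a child of a node of connective `c`. -/
def Bp {n : ℕ} (c : Bool) (t : AT n) : Prop := WF t ∧ rootConn t ≠ some c

/-- Well-formed trees with root connective `c`. -/
def Np {n : ℕ} (c : Bool) (t : AT n) : Prop := WF t ∧ rootConn t = some c

theorem Np_iff {n : ℕ} (c : Bool) (t : AT n) : Np c t ↔ NodeOf c (Bp c) t := by
  unfold Np NodeOf Bp
  constructor
  · rintro ⟨h, h2⟩
    cases h with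
    | leaf i b => simp [rootConn] at h2
    | node c' ts h1 h3 h4 =>
      simp only [rootConn, Option.some.injEq] at h2
      subst h2
      exact ⟨ts, ⟨h1, fun s hs => ⟨h3 s hs, h4 s hs⟩⟩, rfl⟩
  · rintro ⟨ts, ⟨h1, h2⟩, rfl⟩
    exact ⟨WF.node c ts h1 (fun t ht => (h2 t ht).1) (fun t ht => (h2 t ht).2), rfl⟩

theorem Bp_iff {n : ℕ} (c : Bool) (t : AT n) : Bp c t ↔ (isLeafB t = true ∨ Np (!c) t) := by
  unfold Bp Np
  cases t with
  | leaf i b => simp [isLeafB, rootConn, WF.leaf]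
  | node d ts => cases c <;> cases d <;> simp [isLeafB, rootConn]

theorem GF_Bp {n : ℕ} (c : Bool) :
    GF size (Bp (n := n) c) = C (2 * n : ℝ) * X + GF size (Np (n := n) (!c)) := by
  rw [GF_congr size (Bp_iff (n := n) c), GF_or size (fin_tree n), GF_leaf]
  intro t h1 h2
  cases t with
  | leaf i b => simp [Np, rootConn] at h2
  | node d ts => simp [isLeafB] at h1

theorem constB {n : ℕ} (P : AT n → Prop) : constantCoeff (GF size P) = 0 := by
  rw [← coeff_zero_eq_constantCoeff_apply]
  simp only [GF, coeff_mk]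
  have : {t : AT n | P t ∧ size t = 0} = ∅ := by
    ext t; have := size_pos' t; simp; omega
  rw [this]; simp

theorem Np_symm {n : ℕ} : GF size (Np (n := n) true) = GF size (Np (n := n) false) := by
  have h1 := GF_node (n := n) true (Bp true)
  have h2 := GF_node (n := n) false (Bp false)
  rw [← GF_congr size (Np_iff (n := n) true)] at h1
  rw [← GF_congr size (Np_iff (n := n) false)] at h2
  have l1 := GF_list (n := n) (Bp true)
  have l2 := GF_list (n := n) (Bp false)
  have b1 := GF_Bp (n := n) true
  have b2 := GF_Bp (n := n) false
  simp only [Bool.not_true, Bool.not_false] at b1 b2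
  have c1 := constB (n := n) (Bp true)
  have c2 := constB (n := n) (Bp false)
  generalize GF sizeList (fun l => ∀ t ∈ l, Bp (n := n) true t) = L1 at *
  generalize GF sizeList (fun l => ∀ t ∈ l, Bp (n := n) false t) = L2 at *
  generalize GF size (Bp (n := n) true) = B1 at *
  generalize GF size (Bp (n := n) false) = B2 at *
  generalize GF size (Np (n := n) true) = N1 at *
  generalize GF size (Np (n := n) false) = N2 at *
  have key : (B1 - B2) * (1 + X * (L1 * L2 - 1)) = 0 := by
    have e1 : B1 ^ 2 * L1 = L1 - 1 - B1 := by linear_combination (-1 - B1) * l1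
    have e2 : B2 ^ 2 * L2 = L2 - 1 - B2 := by linear_combination (-1 - B2) * l2
    have e3 : L1 - L2 = L1 * L2 * (B1 - B2) := by linear_combination L2 * l1 - L1 * l2
    rw [e1] at h1
    rw [e2] at h2
    linear_combination b1 - b2 + h2 - h1 - X * e3
  have hne : (1 + X * (L1 * L2 - 1) : ℝ⟦X⟧) ≠ 0 := by
    intro h
    have := congrArg constantCoeff h
    simp at this
  have := (mul_eq_zero.mp key).resolve_right hne
  linear_combination b1 - b2 - this

theorem count_eq {n : ℕ} (S : Set (AT n)) (m : ℕ) :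
    (countIn n S m : ℝ) = coeff m (GF size (fun t => t ∈ S ∧ WF t)) := by
  simp only [GF, coeff_mk, countIn]
  rw [← Nat.card_coe_set_eq]
  congr 2
  simp only [Set.coe_ofPred, and_assoc]

theorem GF_split {n : ℕ} (P : AT n → Prop) :
    GF size P = GF size (fun t => P t ∧ isLeafB t = true) +
      (GF size (fun t => P t ∧ rootConn t = some true) +
       GF size (fun t => P t ∧ rootConn t = some false)) := by
  rw [← GF_or size (fin_tree n), ← GF_or size (fin_tree n)]
  · apply GF_congr
    intro t
    cases t with
    | leaf i b => simp [isLeafB, rootConn]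
    | node c ts => cases c <;> simp [isLeafB, rootConn]
  · intro t h1 h2
    cases t with
    | leaf i b => simp [rootConn] at h2
    | node c ts => simp [isLeafB] at h1
  · intro t h1 h2
    rw [h1.2] at h2; simp at h2

theorem A0_iff {n : ℕ} (c : Bool) (t : AT n) :
    ((t ∈ A0fam n ∧ WF t) ∧ rootConn t = some c) ↔ NodeOf c (Np (!c)) t := by
  unfold Np NodeOf A0fam
  constructor
  · rintro ⟨⟨⟨_, h0⟩, h⟩, h2⟩
    cases h with
    | leaf i b => simp [rootConn] at h2
    | node c' ts h1 h3 h4 =>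
      simp only [rootConn, Option.some.injEq] at h2
      subst h2
      refine ⟨ts, ⟨h1, fun s hs => ⟨h3 s hs, ?_⟩⟩, rfl⟩
      have a := h0 s hs
      have b := h4 s hs
      cases s with
      | leaf i b => simp [isLeafB] at a
      | node d us => cases d <;> cases c' <;> simp [rootConn] at b ⊢
  · rintro ⟨ts, ⟨h1, h2⟩, rfl⟩
    refine ⟨⟨⟨?_, ?_⟩, WF.node c ts h1 (fun t ht => (h2 t ht).1) (fun t ht => ?_)⟩, rfl⟩
    · rcases ts with _ | ⟨a, _ | ⟨b, l⟩⟩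
      · simp at h1
      · simp at h1
      · have := size_pos' a
        have := size_pos' b
        simp [size, sizeList]; omega
    · intro s hs
      have := (h2 s hs).2
      cases s with
      | leaf i b => simp [rootConn] at this
      | node d us => rfl
    · rw [(h2 t ht).2]; cases c <;> simp

/-- All the algebraic information on the generating functions. -/
theorem comb_main (n : ℕ) : ∃ B N L F M : ℝ⟦X⟧,
    (∀ m, (A n m : ℝ) = coeff m (C (2 * n : ℝ) * X + C 2 * N)) ∧
    (∀ m, (countIn n (A0fam n) m : ℝ) = coeff m (C 2 * F)) ∧
    B = C (2 * n : ℝ) * X + N ∧ N = X * (B ^ 2 * L) ∧ L * (1 - B) = 1 ∧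
    F = X * (N ^ 2 * M) ∧ M * (1 - N) = 1 := by
  have l1 := GF_list (n := n) (Bp true)
  have b1 := GF_Bp (n := n) true
  have h1 := GF_node (n := n) true (Bp true)
  rw [← GF_congr size (Np_iff (n := n) true), Np_symm] at h1
  have f1 := GF_node (n := n) true (Np false)
  have f2 := GF_node (n := n) false (Np true)
  have m1 := GF_list (n := n) (Np false)
  have m2 := GF_list (n := n) (Np true)
  refine ⟨_, _, _, _, _, ?_, ?_, b1, h1, l1, f1, m1⟩
  · intro m
    rw [A, count_eq, GF_split]
    congr 1
    congr 1
    · rw [← GF_leaf]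
      apply GF_congr
      intro t
      cases t with
      | leaf i b => simp [isLeafB, WF.leaf]
      | node d us => simp [isLeafB]
    · have e : ∀ c, GF size (fun t : AT n => (t ∈ Set.univ ∧ WF t) ∧ rootConn t = some c) =
          GF size (Np (n := n) c) := by
        intro c; apply GF_congr; intro t; simp [Np]
      rw [e, e, Np_symm, Bool.not_true]
      have : (C (2 : ℝ) : ℝ⟦X⟧) = 2 := map_ofNat C 2
      rw [this]; ring
  · intro m
    rw [count_eq, GF_split]
    congr 1
    have e0 : GF size (fun t : AT n => (t ∈ A0fam n ∧ WF t) ∧ isLeafB t = true) = 0 := by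
      ext m
      simp only [GF, coeff_mk, map_zero]
      have : {t : AT n | ((t ∈ A0fam n ∧ WF t) ∧ isLeafB t = true) ∧ size t = m} = ∅ := by
        ext t
        cases t with
        | leaf i b => simp [A0fam, size]
        | node d us => simp [isLeafB]
      rw [this]; simp
    rw [e0, GF_congr size (A0_iff (n := n) true), GF_congr size (A0_iff (n := n) false)]
    simp only [Bool.not_true, Bool.not_false]
    have : GF size (NodeOf (n := n) false (Np true)) = GF size (NodeOf (n := n) true (Np false)) := by
      rw [f1, f2]
      rw [Np_symm] at m2 ⊢
      have : GF sizeList (fun l => ∀ t ∈ l, Np (n := n) true t) =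
          GF sizeList (fun l => ∀ t ∈ l, Np (n := n) false t) := by
        generalize GF sizeList (fun l => ∀ t ∈ l, Np (n := n) true t) = U at *
        generalize GF sizeList (fun l => ∀ t ∈ l, Np (n := n) false t) = V at *
        linear_combination V * m2 - U * m1
      rw [this]
    rw [this]
    have : (C (2 : ℝ) : ℝ⟦X⟧) = 2 := map_ofNat C 2
    rw [this]; ring

end Comb

section Ana
open PowerSeries Filter Topology

theorem contr1 (v e : ℕ → ℝ) (r : ℝ) (hr0 : 0 ≤ r) (hr : r < 1) (hv : ∀ m, 0 ≤ v m)
    (h : ∀ m, v (m + 1) ≤ r * v m + e m) (he : Tendsto e atTop (𝓝 0)) :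
    Tendsto v atTop (𝓝 0) := by
  rw [Metric.tendsto_atTop]
  intro δ hδ
  have h1 : ∀ᶠ m in atTop, e m < δ / 2 * (1 - r) :=
    he.eventually (gt_mem_nhds (by have : 0 < 1 - r := by linarith
                                   positivity))
  obtain ⟨K, hK⟩ := eventually_atTop.mp h1
  have h2 : ∀ j, v (K + j) - δ / 2 ≤ r ^ j * |v K - δ / 2| := by
    intro j
    induction j with
    | zero => simpa using le_abs_self (v K - δ / 2)
    | succ j ih =>
      have a := h (K + j)
      have b := hK (K + j) (by omega)
      have c := mul_le_mul_of_nonneg_left ih hr0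
      rw [← add_assoc, pow_succ]
      nlinarith
  have h3 : Tendsto (fun j => r ^ j * |v K - δ / 2|) atTop (𝓝 0) := by
    simpa using (tendsto_pow_atTop_nhds_zero_of_lt_one hr0 hr).mul_const (|v K - δ / 2|)
  obtain ⟨J, hJ⟩ := eventually_atTop.mp (h3.eventually (gt_mem_nhds (half_pos hδ)))
  refine ⟨K + J, fun m hm => ?_⟩
  obtain ⟨j, rfl⟩ := Nat.exists_eq_add_of_le hm
  have a := h2 (J + j)
  have b := hJ (J + j) (by omega)
  rw [← add_assoc] at a
  rw [Real.dist_eq, sub_zero, abs_of_nonneg (hv _)]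
  linarith

theorem contr2 (u e : ℕ → ℝ) (p q : ℝ) (hp : 0 ≤ p) (hq : 0 ≤ q) (hpq : p + q < 1)
    (h : ∀ m, |u (m + 2)| ≤ p * |u (m + 1)| + q * |u m| + e m) (he : Tendsto e atTop (𝓝 0)) :
    Tendsto u atTop (𝓝 0) := by
  set c : ℝ := (q + 1 - p) / 2 with hc
  have c0 : 0 < c := by rw [hc]; linarith
  have hqc : q < c := by rw [hc]; linarith
  have hpc : p + c < 1 := by rw [hc]; linarith
  set r := max (p + c) (q / c) with hr
  have r1 : r < 1 := max_lt hpc (by rw [div_lt_one c0]; exact hqc)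
  have r0 : 0 ≤ r := le_trans (by linarith) (le_max_left _ _)
  have hrp : p + c ≤ r := le_max_left _ _
  have hrq : q ≤ r * c := by rw [← div_le_iff₀ c0]; exact le_max_right _ _
  have key : Tendsto (fun m => |u (m + 1)| + c * |u m|) atTop (𝓝 0) := by
    refine contr1 _ e r r0 r1 (fun m => by positivity) (fun m => ?_) he
    have a := h m
    have b := mul_le_mul_of_nonneg_right hrp (abs_nonneg (u (m + 1)))
    have d := mul_le_mul_of_nonneg_right hrq (abs_nonneg (u m))
    show |u (m + 2)| + c * |u (m + 1)| ≤ _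
    nlinarith
  have : Tendsto (fun m => u (m + 1)) atTop (𝓝 0) := by
    refine squeeze_zero_norm (fun m => ?_) key
    rw [Real.norm_eq_abs]
    have : 0 ≤ c * |u m| := by positivity
    linarith
  exact (tendsto_add_atTop_iff_nat 1).mp this

theorem contr3 (u a b g : ℕ → ℝ) (p q a' b' g' : ℝ) (hp : 0 ≤ p) (hq : 0 ≤ q) (hpq : p + q < 1)
    (ha : ∀ m, |a m| ≤ p) (hb : ∀ m, |b m| ≤ q)
    (h : ∀ m, u (m + 2) = a m * u (m + 1) + b m * u m + g m)
    (hta : Tendsto a atTop (𝓝 a')) (htb : Tendsto b atTop (𝓝 b')) (htg : Tendsto g atTop (𝓝 g'))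
    (l : ℝ) (hl : l = a' * l + b' * l + g') :
    Tendsto u atTop (𝓝 l) := by
  have he : Tendsto (fun m => |a m * l + b m * l + g m - l|) atTop (𝓝 0) := by
    have : Tendsto (fun m => a m * l + b m * l + g m - l) atTop (𝓝 (a' * l + b' * l + g' - l)) :=
      (((hta.mul_const l).add (htb.mul_const l)).add htg).sub_const l
    rw [← hl, sub_self] at this
    simpa using this.abs
  have := contr2 (fun m => u m - l) _ p q hp hq hpq (fun m => ?_) he
  · have := this.add_const l
    simpa using this
  · have e : u (m + 2) - l = a m * (u (m + 1) - l) + b m * (u m - l) +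
        (a m * l + b m * l + g m - l) := by rw [h]; ring
    show |u (m + 2) - l| ≤ _
    rw [e]
    refine (abs_add_three _ _ _).trans ?_
    rw [abs_mul, abs_mul]
    have := mul_le_mul_of_nonneg_right (ha m) (abs_nonneg (u (m + 1) - l))
    have := mul_le_mul_of_nonneg_right (hb m) (abs_nonneg (u m - l))
    linarith

/-- Lower bound on the ratios of the coefficients of the square root of the discriminant. -/
theorem d_ratio (k : ℝ) (hk : 2 ≤ k) (d : ℕ → ℝ) (h2 : d 2 = - 2 * k)
    (hrec : ∀ m : ℕ, 2 ≤ m → ((m : ℝ) + 1) * d (m + 1) =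
      k * (2 * m - 1) * d m - (k ^ 2 - 4 * k) * (m - 2) * d (m - 1)) :
    (∀ m, 2 ≤ m → d m < 0) ∧ (∀ m, 5 ≤ m → k + 1 ≤ d (m + 1) / d m) ∧
    Tendsto (fun m => d (m + 1) / d m) atTop (𝓝 (k + 2 * √k)) := by
  have k0 : 0 < k := by linarith
  -- one step
  have step : ∀ m : ℕ, 2 ≤ m → d m < 0 → k ≤ d (m + 1) / d m →
      d (m + 1) < 0 ∧ d (m + 2) / d (m + 1) = k * (2 * m + 1) / (m + 2) -
        ((k ^ 2 - 4 * k) * (m - 1) / (m + 2)) / (d (m + 1) / d m) ∧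
      k + (2 * m - 2) / (m + 2) ≤ d (m + 2) / d (m + 1) := by
    intro m hm hd hx
    have hm' : (2 : ℝ) ≤ m := by exact_mod_cast hm
    have hd1 : d (m + 1) ≤ k * d m := by
      rwa [le_div_iff_of_neg hd] at hx
    have hd1' : d (m + 1) < 0 := by nlinarith
    have hr := hrec (m + 1) (by omega)
    simp only [Nat.add_sub_cancel] at hr
    push_cast at hr
    have e : d (m + 2) / d (m + 1) = k * (2 * m + 1) / (m + 2) -
        ((k ^ 2 - 4 * k) * (m - 1) / (m + 2)) / (d (m + 1) / d m) := by
      have hd0 := hd.ne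
      have hd10 := hd1'.ne
      have hm2 : (m : ℝ) + 2 ≠ 0 := by linarith
      field_simp
      linear_combination hr
    refine ⟨hd1', e, ?_⟩
    rw [e]
    set x := d (m + 1) / d m with hxdef
    have x0 : 0 < x := by linarith
    have hm2 : (0 : ℝ) < (m : ℝ) + 2 := by linarith
    have e2 : k * (2 * m + 1) / (m + 2) - ((k ^ 2 - 4 * k) * (m - 1) / (m + 2)) / x
       - (k + (2 * m - 2) / (m + 2)) =
       (m - 1) / (m + 2) * ((k * (x - k) + (4 * k - 2 * x)) / x) := by
      field_simp
      ring
    have : 0 ≤ ((m : ℝ) - 1) / (m + 2) * ((k * (x - k) + (4 * k - 2 * x)) / x) := by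
      apply mul_nonneg
      · apply div_nonneg <;> linarith
      · apply div_nonneg _ x0.le
        nlinarith [mul_nonneg (sub_nonneg.2 hk) (sub_nonneg.2 hx)]
    linarith
  have base : d 2 < 0 ∧ k ≤ d 3 / d 2 := by
    have h := hrec 2 le_rfl
    norm_num at h
    have hd : d 2 < 0 := by rw [h2]; linarith
    refine ⟨hd, ?_⟩
    rw [le_div_iff_of_neg hd]
    linarith
  have all : ∀ j : ℕ, d (j + 2) < 0 ∧ k ≤ d (j + 2 + 1) / d (j + 2) := by
    intro j
    induction j with
    | zero => exact base
    | succ j ih =>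
      obtain ⟨a, _, c⟩ := step (j + 2) (by omega) ih.1 ih.2
      rw [show j + 1 + 2 = j + 2 + 1 by omega]
      refine ⟨a, le_trans ?_ c⟩
      have : (0 : ℝ) ≤ (2 * ((j + 2 : ℕ) : ℝ) - 2) / (((j + 2 : ℕ) : ℝ) + 2) := by
        push_cast
        apply div_nonneg
        · have : (0 : ℝ) ≤ j := by positivity
          linarith
        · positivity
      linarith
  refine ⟨fun m hm => ?_, fun m hm => ?_, ?_⟩
  · obtain ⟨j, rfl⟩ := Nat.exists_eq_add_of_le hm
    rw [add_comm]; exact (all j).1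
  · obtain ⟨j, rfl⟩ := Nat.exists_eq_add_of_le hm
    obtain ⟨a, b⟩ := all (j + 2)
    obtain ⟨_, _, c⟩ := step (j + 2 + 2) (by omega) a b
    rw [show 5 + j = j + 2 + 2 + 1 by omega]
    refine le_trans ?_ c
    have : (1 : ℝ) ≤ (2 * ((j + 2 + 2 : ℕ) : ℝ) - 2) / (((j + 2 + 2 : ℕ) : ℝ) + 2) := by
      push_cast
      rw [le_div_iff₀ (by positivity)]
      have : (0 : ℝ) ≤ j := by positivity
      linarith
    linarith
  · -- the limit
    set s := √k with hs
    have s0 : 0 < s := Real.sqrt_pos.2 k0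
    have ss : s ^ 2 = k := Real.sq_sqrt k0.le
    set x : ℕ → ℝ := fun j => d (j + 2 + 1) / d (j + 2) with hx
    have hxk : ∀ j, k ≤ x j := fun j => (all j).2
    have hXpos : 0 < k + 2 * s := by linarith
    have hXk : k * (k + 2 * s) ≠ 0 := by positivity
    have hX : k + 2 * s = 2 * k - (k ^ 2 - 4 * k) / (k + 2 * s) := by
      field_simp
      linear_combination 4 * ss
    have hj : Tendsto (fun j : ℕ => (1 : ℝ) / ((j : ℝ) + 4)) atTop (𝓝 0) := by
      have := (tendsto_add_atTop_iff_nat 3).mpr (tendsto_one_div_add_atTop_nhds_zero_nat (𝕜 := ℝ))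
      refine this.congr fun j => ?_
      push_cast; ring
    set q : ℝ := |k - 4| / (k + 2 * s) with hq
    have q1 : q < 1 := by
      rw [hq, div_lt_one hXpos, abs_lt]
      constructor <;> nlinarith
    have lim : Tendsto (fun j => |x j - (k + 2 * s)|) atTop (𝓝 0) := by
      refine contr1 _ (fun j => (3 * k + 3 * |k - 4|) * (1 / ((j : ℝ) + 4))) q (by positivity) q1
        (fun j => abs_nonneg _) (fun j => ?_) ?_
      · obtain ⟨a, b, _⟩ := step (j + 2) (by omega) (all j).1 (all j).2
        have b' : x (j + 1) = k * (2 * j + 5) / (j + 4) -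
            ((k ^ 2 - 4 * k) * (j + 1) / (j + 4)) / x j := by
          rw [hx]
          show d (j + 1 + 2 + 1) / d (j + 1 + 2) = _
          rw [show j + 1 + 2 + 1 = j + 2 + 2 by omega, show j + 1 + 2 = j + 2 + 1 by omega, b]
          push_cast
          ring
        have xj := hxk j
        have xj0 : 0 < x j := by linarith
        have j4 : (0 : ℝ) < (j : ℝ) + 4 := by positivity
        have e : x (j + 1) - (k + 2 * s) = - (3 * k) * (1 / ((j : ℝ) + 4)) +
            3 * (k - 4) * (1 / ((j : ℝ) + 4)) * (k / x j) +
            (k - 4) / (k + 2 * s) * (k / x j) * (x j - (k + 2 * s)) := by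
          rw [b']
          conv_lhs => rw [hX]
          field_simp
          ring
        rw [e]
        have hkx : |k / x j| ≤ 1 := by
          rw [abs_of_nonneg (by positivity), div_le_one xj0]; exact xj
        have j4' : |1 / ((j : ℝ) + 4)| = 1 / ((j : ℝ) + 4) := abs_of_nonneg (by positivity)
        refine (abs_add_three _ _ _).trans ?_
        have t1 : |-(3 * k) * (1 / ((j : ℝ) + 4))| = 3 * k * (1 / ((j : ℝ) + 4)) := by
          rw [abs_mul, j4', abs_neg, abs_of_nonneg (by positivity)]
        have t2 : |3 * (k - 4) * (1 / ((j : ℝ) + 4)) * (k / x j)| ≤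
            3 * |k - 4| * (1 / ((j : ℝ) + 4)) := by
          rw [abs_mul, abs_mul, j4', abs_mul, abs_of_nonneg (by norm_num : (0 : ℝ) ≤ 3)]
          exact mul_le_of_le_one_right (by positivity) hkx
        have t3 : |(k - 4) / (k + 2 * s) * (k / x j) * (x j - (k + 2 * s))| ≤
            q * |x j - (k + 2 * s)| := by
          rw [abs_mul, abs_mul, abs_div, abs_of_pos hXpos]
          apply mul_le_mul_of_nonneg_right _ (abs_nonneg _)
          exact mul_le_of_le_one_right (by positivity) hkx
        rw [t1]
        linarith
      · simpa using hj.const_mul (3 * k + 3 * |k - 4|)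
    have lim2 : Tendsto x atTop (𝓝 (k + 2 * s)) := by
      rw [tendsto_iff_norm_sub_tendsto_zero]
      exact lim
    exact (tendsto_add_atTop_iff_nat (f := fun m => d (m + 1) / d m) 2).mp lim2

end Ana

section Fin
open PowerSeries Filter Topology

/-- The common ratio limit, where `k = 2n`. -/
noncomputable def rhoK (k : ℝ) : ℝ := 1 / (k + 2 * √k)

/-- The limiting ratio, where `k = 2n`. -/
noncomputable def muK (k : ℝ) : ℝ := (1 + rhoK k) / (k + (1 + k * rhoK k) ^ 2) - rhoK k

/-- Coefficient recurrences deduced from the algebraic equations. -/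
theorem coeff_main (k : ℝ) (B N L F M : ℝ⟦X⟧) (hB : B = C k * X + N) (hN : N = X * (B ^ 2 * L))
    (hL : L * (1 - B) = 1) (hF : F = X * (N ^ 2 * M)) (hM : M * (1 - N) = 1) :
    ∃ d : ℕ → ℝ, d 2 = - 2 * k ∧
      (∀ m : ℕ, 2 ≤ m → ((m : ℝ) + 1) * d (m + 1) =
        k * (2 * m - 1) * d m - (k ^ 2 - 4 * k) * (m - 2) * d (m - 1)) ∧
      (∀ m, d (m + 3) = - 2 * (coeff (m + 3) N + coeff (m + 2) N)) ∧
      (∀ m, (k + 1) * coeff (m + 4) F + 2 * k * coeff (m + 3) F + k ^ 2 * coeff (m + 2) F =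
        coeff (m + 4) N - k * coeff (m + 3) N - 2 * k * coeff (m + 2) N
          - k ^ 2 * coeff (m + 1) N) := by
  have quad : (1 + X) * B ^ 2 - (1 + C k * X) * B + C k * X = 0 := by
    linear_combination (-(1 - B)) * hB - (1 - B) * hN - X * B ^ 2 * hL
  set D : ℝ⟦X⟧ := 1 + C k * X - 2 * (1 + X) * B with hD
  have D2 : D ^ 2 = 1 - 2 * C k * X + (C k ^ 2 - 4 * C k) * X ^ 2 := by
    rw [hD]; linear_combination 4 * (1 + X) * quad
  have DD : 2 * ((1 - 2 * C k * X + (C k ^ 2 - 4 * C k) * X ^ 2) * d⁄dX ℝ D) =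
      (- 2 * C k + 2 * (C k ^ 2 - 4 * C k) * X) * D := by
    have hP : d⁄dX ℝ (1 - 2 * C k * X + (C k ^ 2 - 4 * C k) * X ^ 2 : ℝ⟦X⟧) =
        - 2 * C k + 2 * (C k ^ 2 - 4 * C k) * X := by
      have : (1 - 2 * C k * X + (C k ^ 2 - 4 * C k) * X ^ 2 : ℝ⟦X⟧) =
          1 - C (2 * k) * X + C (k ^ 2 - 4 * k) * (X * X) := by
        simp only [map_mul, map_sub, map_pow, map_ofNat]; ring
      rw [this, map_add, map_sub, Derivation.leibniz, Derivation.leibniz, Derivation.leibniz,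
        derivative_C, derivative_C, derivative_X, Derivation.map_one_eq_zero]
      simp only [smul_eq_mul, map_mul, map_sub, map_pow, map_ofNat]
      ring
    have h := congrArg (d⁄dX ℝ) D2
    rw [hP, pow_two, Derivation.leibniz, smul_eq_mul] at h
    linear_combination D * h - 2 * d⁄dX ℝ D * D2
  have D0 : coeff 0 D = 1 := by
    have : constantCoeff B = 0 := by rw [hB, hN]; simp
    rw [hD]; simp [this]
  have DD' : C 2 * (d⁄dX ℝ D) - C (4 * k) * (X * d⁄dX ℝ D) +
      C (2 * (k ^ 2 - 4 * k)) * (X * (X * d⁄dX ℝ D)) =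
      C (- 2 * k) * D + C (2 * (k ^ 2 - 4 * k)) * (X * D) := by
    simp only [map_mul, map_sub, map_neg, map_pow, map_ofNat] at DD ⊢
    linear_combination DD
  have c0 := congrArg (coeff 0) DD'
  have c1 := congrArg (coeff (0 + 1)) DD'
  have cc := fun m => congrArg (coeff (m + 2)) DD'
  have hDN : D = 1 - C k * X - C (2 * k) * (X * X) - C 2 * N - C 2 * (X * N) := by
    rw [hD, hB]
    simp only [map_mul, map_ofNat]
    ring
  have hFN : C (k + 1) * F + C (2 * k) * (X * F) + C (k ^ 2) * (X * (X * F)) =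
      N - C k * (X * N) - C (2 * k) * (X * (X * N)) - C (k ^ 2) * (X * (X * (X * N)))
       - C (k ^ 2) * (X * (X * X)) := by
    have quadN : (1 + X) * N ^ 2 + (- 1 + C k * X + 2 * C k * X ^ 2) * N + C k ^ 2 * X ^ 3 = 0 := by
      rw [hB] at quad
      linear_combination quad
    have hF' : F = X * (M - 1 - N) := by
      rw [hF]; linear_combination (-(1 + N) * X) * hM
    have hW : X * (C k + (1 + C k * X) ^ 2) * M =
        1 + 2 * X + C k * X + 2 * C k * X ^ 2 - (1 + X) * (1 - N) := by
      linear_combination (1 + 2 * X + C k * X + 2 * C k * X ^ 2 - (1 + X) * (1 - N)) * hM +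
        M * quadN
    rw [hF']
    simp only [map_mul, map_ofNat, map_pow, map_add, map_one]
    linear_combination hW
  have fn := fun m => congrArg (coeff (m + 4)) hFN
  refine ⟨fun m => coeff m D, ?_, ?_, ?_, ?_⟩
  · simp only [LinearMap.map_add, LinearMap.map_sub, coeff_C_mul, coeff_succ_X_mul,
      coeff_zero_X_mul, coeff_derivative, D0] at c0 c1
    norm_num at c0 c1
    show coeff 2 D = _
    linear_combination c1 / 4 + k / 4 * c0
  · intro m hm
    obtain ⟨j, rfl⟩ := Nat.exists_eq_add_of_le hm
    have h := cc j
    simp only [map_add, map_sub, coeff_C_mul, coeff_succ_X_mul, coeff_derivative] at h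
    push_cast at h ⊢
    rw [show 2 + j = j + 2 by omega, show j + 2 - 1 = j + 1 by omega]
    linear_combination h / 2
  · intro m
    show coeff (m + 3) D = _
    rw [hDN]
    simp only [map_add, map_sub, coeff_C_mul, coeff_succ_X_mul, coeff_X, coeff_one]
    simp
    ring
  · intro m
    have h := fn m
    simp only [LinearMap.map_add, LinearMap.map_sub, coeff_C_mul, coeff_succ_X_mul, coeff_X] at h
    simp at h
    linear_combination h

theorem lim_main (k : ℝ) (hk : 2 ≤ k) (d N F : ℕ → ℝ) (h2 : d 2 = - 2 * k)
    (hrec : ∀ m : ℕ, 2 ≤ m → ((m : ℝ) + 1) * d (m + 1) =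
        k * (2 * m - 1) * d m - (k ^ 2 - 4 * k) * (m - 2) * d (m - 1))
    (hN : ∀ m, d (m + 3) = - 2 * (N (m + 3) + N (m + 2)))
    (hF : ∀ m, (k + 1) * F (m + 4) + 2 * k * F (m + 3) + k ^ 2 * F (m + 2) =
        N (m + 4) - k * N (m + 3) - 2 * k * N (m + 2) - k ^ 2 * N (m + 1)) :
    Tendsto (fun m => F m / N m) atTop (𝓝 (muK k)) := by
  obtain ⟨dneg, dk, dlim⟩ := d_ratio k hk d h2 hrec
  have k0 : 0 < k := by linarith
  have s0 : 0 < √k := Real.sqrt_pos.2 k0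
  set α : ℕ → ℝ := fun m => d m / d (m + 1) with hα
  have αlim : Tendsto α atTop (𝓝 (rhoK k)) := by
    have := dlim.inv₀ (by positivity)
    rw [rhoK, one_div]
    refine this.congr fun m => ?_
    rw [hα, inv_div]
  have αb : ∀ m, 5 ≤ m → |α m| ≤ 1 / (k + 1) := by
    intro m hm
    have := dk m hm
    have e : α m = 1 / (d (m + 1) / d m) := by rw [hα, one_div, inv_div]
    rw [e, abs_of_nonneg (by apply div_nonneg zero_le_one; linarith)]
    exact one_div_le_one_div_of_le (by linarith) this
  have ρ0 : 0 < rhoK k := by rw [rhoK]; positivity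
  set ρ := rhoK k with hρ
  have αs : ∀ i, Tendsto (fun j => α (j + i)) atTop (𝓝 ρ) :=
    fun i => (tendsto_add_atTop_iff_nat i).mpr αlim
  set y : ℕ → ℝ := fun m => N m / d m with hy
  set r : ℕ → ℝ := fun m => F m / d m with hr
  set Y : ℝ := - 1 / (2 * (1 + ρ)) with hY
  have Y0 : Y ≠ 0 := by
    rw [hY]; apply div_ne_zero <;> [norm_num; positivity]
  have h13 : 1 / (k + 1) ≤ 1 / 3 := one_div_le_one_div_of_le (by norm_num) (by linarith)
  have ylim : Tendsto y atTop (𝓝 Y) := by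
    apply (tendsto_add_atTop_iff_nat 8).mp
    refine contr3 (fun j => y (j + 8)) (fun j => - α (j + 9)) (fun _ => 0) (fun _ => - 1 / 2)
      (1 / 3) 0 (-ρ) 0 (- 1 / 2) (by norm_num) le_rfl (by norm_num) ?_ (by simp) ?_ (αs 9).neg
      tendsto_const_nhds tendsto_const_nhds Y ?_
    · intro m; rw [abs_neg]; exact (αb _ (by omega)).trans h13
    · intro m
      have h := hN (m + 7)
      have a := (dneg (m + 10) (by omega)).ne
      have b := (dneg (m + 9) (by omega)).ne
      simp only [hy, hα]
      rw [show m + 2 + 8 = m + 10 by omega, show m + 1 + 8 = m + 9 by omega,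
        show m + 9 + 1 = m + 10 by omega]
      rw [show m + 7 + 3 = m + 10 by omega, show m + 7 + 2 = m + 9 by omega] at h
      field_simp
      linear_combination h
    · rw [hY]; field_simp; ring
  have ys : ∀ i, Tendsto (fun j => y (j + i)) atTop (𝓝 Y) :=
    fun i => (tendsto_add_atTop_iff_nat i).mpr ylim
  have k1 : 0 < k + 1 := by linarith
  have rlim : Tendsto r atTop (𝓝 (muK k * Y)) := by
    apply (tendsto_add_atTop_iff_nat 9).mp
    refine contr3 (fun j => r (j + 9)) (fun j => - (2 * k / (k + 1)) * α (j + 10))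
      (fun j => - (k ^ 2 / (k + 1)) * (α (j + 10) * α (j + 9)))
      (fun j => (y (j + 11) - k * (α (j + 10) * y (j + 10)) -
        2 * k * (α (j + 10) * α (j + 9) * y (j + 9)) -
        k ^ 2 * (α (j + 10) * α (j + 9) * α (j + 8) * y (j + 8))) / (k + 1))
      (2 * k / (k + 1) * (1 / (k + 1))) (k ^ 2 / (k + 1) * (1 / (k + 1) * (1 / (k + 1))))
      (- (2 * k / (k + 1)) * ρ) (- (k ^ 2 / (k + 1)) * (ρ * ρ))
      ((Y - k * (ρ * Y) - 2 * k * (ρ * ρ * Y) - k ^ 2 * (ρ * ρ * ρ * Y)) / (k + 1))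
      (by positivity) (by positivity) ?_ ?_ ?_ ?_ ((αs 10).const_mul _)
      (((αs 10).mul (αs 9)).const_mul _) ?_ _ ?_
    · have e : 2 * k / (k + 1) * (1 / (k + 1)) + k ^ 2 / (k + 1) * (1 / (k + 1) * (1 / (k + 1)))
        = (2 * k * (k + 1) + k ^ 2) / (k + 1) ^ 3 := by field_simp
      rw [e, div_lt_one (by positivity)]
      nlinarith [mul_nonneg k0.le (sub_nonneg.2 hk), mul_nonneg (mul_nonneg k0.le k0.le) (sub_nonneg.2 hk)]
    · intro m
      rw [abs_mul, abs_neg, abs_of_pos (by positivity : 0 < 2 * k / (k + 1))]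
      exact mul_le_mul_of_nonneg_left (αb _ (by omega)) (by positivity)
    · intro m
      rw [abs_mul, abs_neg, abs_of_pos (by positivity : 0 < k ^ 2 / (k + 1)), abs_mul]
      exact mul_le_mul_of_nonneg_left (mul_le_mul (αb _ (by omega)) (αb _ (by omega))
        (abs_nonneg _) (by positivity)) (by positivity)
    · intro m
      have h := hF (m + 7)
      have a := (dneg (m + 11) (by omega)).ne
      have b := (dneg (m + 10) (by omega)).ne
      have c := (dneg (m + 9) (by omega)).ne
      have c' := (dneg (m + 8) (by omega)).ne
      simp only [hy, hα, hr]
      simp only [add_assoc, Nat.reduceAdd] at h ⊢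
      field_simp
      linear_combination h
    · exact ((((ys 11).sub (((αs 10).mul (ys 10)).const_mul k)).sub
        ((((αs 10).mul (αs 9)).mul (ys 9)).const_mul (2 * k))).sub
        (((((αs 10).mul (αs 9)).mul (αs 8)).mul (ys 8)).const_mul (k ^ 2))).div_const (k + 1)
    · have hQ : 0 < k + (1 + k * ρ) ^ 2 := by positivity
      have hmu : muK k * (k + (1 + k * ρ) ^ 2) = 1 + ρ - ρ * (k + (1 + k * ρ) ^ 2) := by
        rw [muK, ← hρ, sub_mul, div_mul_cancel₀ _ hQ.ne']
      generalize muK k = μ at *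
      field_simp
      linear_combination hmu
  have := rlim.div ylim Y0
  rw [mul_div_cancel_right₀ _ Y0] at this
  refine this.congr' ?_
  filter_upwards [eventually_ge_atTop 2] with m hm
  simp only [Pi.div_apply, hr, hy]
  rw [div_div_div_cancel_right₀ (dneg m hm).ne]

theorem no_WF_zero (t : AT 0) (h : WF t) : False := by
  induction h with
  | leaf i b => exact i.elim0
  | node c ts h1 h2 h3 ih =>
    cases ts with
    | nil => simp at h1
    | cons a l => exact ih a (by simp)

theorem hasLim_zero : HasLimRatio 0 (A0fam 0) 0 := by
  have : ratio 0 (A0fam 0) = fun _ => 0 := by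
    funext m
    have : A 0 m = 0 := by
      rw [A, countIn, Nat.card_eq_zero]
      left
      exact ⟨fun t => no_WF_zero t.1 t.2.2.1⟩
    rw [ratio, this]; simp
  rw [HasLimRatio, this]
  exact tendsto_const_nhds

theorem hasLim_pos (n : ℕ) (hn : 1 ≤ n) : HasLimRatio n (A0fam n) (muK (2 * n)) := by
  obtain ⟨B, N, L, F, M, hA, hA0, hB, hN, hL, hF, hM⟩ := comb_main n
  obtain ⟨d, h2, hrec, hd, hf⟩ := coeff_main (2 * n) B N L F M hB hN hL hF hM
  have hn' : (1 : ℝ) ≤ n := by exact_mod_cast hn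
  have := lim_main (2 * n) (by linarith) d (fun m => coeff m N) (fun m => coeff m F) h2 hrec hd hf
  refine this.congr' ?_
  filter_upwards [eventually_ge_atTop 2] with m hm
  rw [ratio, hA, hA0]
  have : m ≠ 1 := by omega
  simp only [map_add, coeff_C_mul, coeff_X, this, if_false, mul_zero, zero_add]
  rw [mul_div_mul_left _ _ two_ne_zero]

theorem muK_eq (s : ℝ) (hs : 0 < s) :
    muK (s ^ 2) = (2 * s ^ 2 + 5 * s + 4) / ((s + 2) * (s ^ 2 + 2 * s + 2) ^ 2) := by
  have e : rhoK (s ^ 2) = 1 / (s * (s + 2)) := by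
    rw [rhoK, Real.sqrt_sq hs.le]; congr 1; ring
  rw [muK, e]
  have e2 : s ^ 2 + (1 + s ^ 2 * (1 / (s * (s + 2)))) ^ 2 =
      (s ^ 2 + 2 * s + 2) ^ 2 / (s + 2) ^ 2 := by
    field_simp; ring
  rw [e2]
  field_simp
  ring

theorem mu_bound (s : ℝ) (hs : 0 < s) : |muK (s ^ 2) - 2 / s ^ 3| ≤ 7 / s ^ 4 := by
  rw [muK_eq s hs]
  have e : (2 * s ^ 2 + 5 * s + 4) / ((s + 2) * (s ^ 2 + 2 * s + 2) ^ 2) - 2 / s ^ 3 =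
     - ((7 * s ^ 4 + 28 * s ^ 3 + 48 * s ^ 2 + 40 * s + 16) /
       (s ^ 3 * ((s + 2) * (s ^ 2 + 2 * s + 2) ^ 2))) := by
    field_simp; ring
  rw [e, abs_neg, abs_of_pos (by positivity), div_le_div_iff₀ (by positivity) (by positivity)]
  have : 7 * (s ^ 3 * ((s + 2) * (s ^ 2 + 2 * s + 2) ^ 2)) -
    (7 * s ^ 4 + 28 * s ^ 3 + 48 * s ^ 2 + 40 * s + 16) * s ^ 4 =
    s ^ 3 * (14 * s ^ 4 + 64 * s ^ 3 + 128 * s ^ 2 + 124 * s + 56) := by ring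
  have : 0 < s ^ 3 * (14 * s ^ 4 + 64 * s ^ 3 + 128 * s ^ 2 + 124 * s + 56) := by positivity
  linarith

end Fin

open Filter in
/-- The limiting ratio of trees with no leaf on the first level exists and is
`1/(n√(2n)) + O(1/n²)` as `n → ∞`. -/
theorem statement6 :
    ∃ μ : ℕ → ℝ, (∀ n : ℕ, HasLimRatio n (A0fam n) (μ n)) ∧
      (fun n : ℕ => μ n - 1 / ((n : ℝ) * Real.sqrt (2 * n)))
        =O[atTop] (fun n : ℕ => 1 / (n : ℝ) ^ 2) := by
  refine ⟨fun n => if n = 0 then 0 else muK (2 * n), fun n => ?_, ?_⟩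
  · rcases Nat.eq_zero_or_pos n with rfl | hn
    · simpa using hasLim_zero
    · simp only [hn.ne', if_false]
      exact hasLim_pos n hn
  · refine Asymptotics.IsBigO.of_bound 7 ?_
    filter_upwards [eventually_ge_atTop 1] with n hn
    have hn0 : n ≠ 0 := by omega
    have hn' : (0 : ℝ) < n := by exact_mod_cast hn
    simp only [hn0, if_false]
    set s := Real.sqrt (2 * n) with hs
    have s0 : 0 < s := Real.sqrt_pos.2 (by positivity)
    have ss : s ^ 2 = 2 * n := Real.sq_sqrt (by positivity)
    have hn2 : (n : ℝ) = s ^ 2 / 2 := by linarith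
    have b := mu_bound s s0
    rw [← ss, Real.norm_eq_abs, Real.norm_of_nonneg (by positivity), hn2]
    have e1 : 1 / (s ^ 2 / 2 * s) = 2 / s ^ 3 := by field_simp
    have e2 : 7 * (1 / (s ^ 2 / 2) ^ 2) = 7 / s ^ 4 + 21 / s ^ 4 := by field_simp; norm_num
    rw [e1, e2]
    have : 0 < 21 / s ^ 4 := by positivity
    linarith
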